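/- Assume 0 ≤ l ≤ c, r > 0, and μ > r(c−l). Fix an integer n ≥ 0 and let W_m(d) = G_m(d) + B_m(d). Suppose s ≥ 0 maximizes W_{n+1} over the feasible set {d ≥ 0 : B_{n+1}(d) ≥ 0} and s′ ≥ 0 maximizes W_n over {d ≥ 0 : B_n(d) ≥ 0}, with both feasible sets nonempty. Then W_{n+1}(s) ≤ W_n(s′); that is, the optimal social benefit per joining customer is nonincreasing in the number of customers present. -/

import Mathlib

open MeasureTheory

/-- Density of the Gamma(n+1, μ) distribution: f_{n,μ}(x) = μ^{n+1} x^n e^{-μx} / n!. -/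
noncomputable def gpdf (n : ℕ) (μ x : ℝ) : ℝ :=
  μ ^ (n + 1) * x ^ n * Real.exp (-(μ * x)) / (n.factorial : ℝ)

/-- Expected CARA utility of a customer quoted lead-time `d` who joins when `n`
customers are present. -/
noncomputable def Bn (R p c l r μ : ℝ) (n : ℕ) (d : ℝ) : ℝ :=
  (∫ x in (0:ℝ)..d, (1 - Real.exp (-(r * (R - p - c * x)))) / r * gpdf n μ x)
  + ∫ x in Set.Ioi d,
      (1 - Real.exp (-(r * (R - p - l * d - (c - l) * x)))) / r * gpdf n μ x

/-- Expected lateness beyond the quoted lead-time `d` in state `n`. -/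
noncomputable def Ln (μ : ℝ) (n : ℕ) (d : ℝ) : ℝ :=
  ∫ x in Set.Ioi d, (x - d) * gpdf n μ x

/-- Provider expected profit from a joining customer in state `n` under quote `d`. -/
noncomputable def Gn (p l μ : ℝ) (n : ℕ) (d : ℝ) : ℝ := p - l * Ln μ n d

theorem gpdf_nonneg {μ x : ℝ} (hμ : 0 < μ) (hx : 0 ≤ x) (n : ℕ) : 0 ≤ gpdf n μ x := by
  unfold gpdf
  positivity

theorem gpdf_succ (n : ℕ) (μ x : ℝ) :
    gpdf (n + 1) μ x = μ * x / (n + 1) * gpdf n μ x := by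
  unfold gpdf
  rw [Nat.factorial_succ]
  push_cast
  have : (n : ℝ) + 1 ≠ 0 := by positivity
  have : (n.factorial : ℝ) ≠ 0 := by positivity
  field_simp
  ring

theorem integrableOn_exp_mul_gpdf {a μ : ℝ} (ha : a < μ) (n : ℕ) :
    IntegrableOn (fun x => Real.exp (a * x) * gpdf n μ x) (Set.Ioi 0) := by
  have h := integrableOn_rpow_mul_exp_neg_mul_rpow (p := 1) (s := n) (b := μ - a)
    (by linarith [(Nat.cast_nonneg n : (0 : ℝ) ≤ n)]) one_pos (by linarith)
  refine IntegrableOn.congr_fun (h.const_mul (μ ^ (n + 1) / n.factorial)) (fun x _ => ?_)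
    measurableSet_Ioi
  have he : Real.exp (-(μ - a) * x) = Real.exp (a * x) * Real.exp (-(μ * x)) := by
    rw [← Real.exp_add]
    ring_nf
  simp only [gpdf, Real.rpow_one, Real.rpow_natCast, he]
  ring

theorem integrableOn_gpdf {μ : ℝ} (hμ : 0 < μ) (n : ℕ) :
    IntegrableOn (gpdf n μ) (Set.Ioi 0) := by
  simpa using integrableOn_exp_mul_gpdf hμ n

theorem integral_gpdf {μ : ℝ} (hμ : 0 < μ) (n : ℕ) : ∫ x in Set.Ioi 0, gpdf n μ x = 1 := by
  have h := Real.integral_rpow_mul_exp_neg_mul_Ioi (a := n + 1) (r := μ) (by positivity) hμ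
  have hg : ∀ x, gpdf n μ x =
      μ ^ (n + 1) / n.factorial * (x ^ ((n : ℝ) + 1 - 1) * Real.exp (-(μ * x))) := by
    intro x
    simp only [gpdf, add_sub_cancel_right, Real.rpow_natCast]
    ring
  simp_rw [hg]
  rw [integral_const_mul, h, Real.Gamma_nat_eq_factorial]
  have : (n.factorial : ℝ) ≠ 0 := by positivity
  have hp : (1 / μ) ^ ((n : ℝ) + 1) = (1 / μ) ^ (n + 1) := by
    exact_mod_cast Real.rpow_natCast (1 / μ) (n + 1)
  rw [hp, one_div_pow]
  field_simp

/-- Stochastic monotonicity of the Gamma(n+1, μ) laws in `n`. -/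
theorem setIntegral_mul_gpdf_le_succ {μ : ℝ} (hμ : 0 < μ) (n : ℕ) {h : ℝ → ℝ} (hh : Monotone h)
    (hi : ∀ m, IntegrableOn (fun x => h x * gpdf m μ x) (Set.Ioi 0)) :
    ∫ x in Set.Ioi 0, h x * gpdf n μ x ≤ ∫ x in Set.Ioi 0, h x * gpdf (n + 1) μ x := by
  set t : ℝ := (n + 1) / μ with ht
  have hcentered : ∀ m, ∫ x in Set.Ioi 0, (h x * gpdf m μ x - h t * gpdf m μ x) =
      (∫ x in Set.Ioi 0, h x * gpdf m μ x) - h t := by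
    intro m
    rw [integral_sub (hi m) ((integrableOn_gpdf hμ m).const_mul _), integral_const_mul,
      integral_gpdf hμ, mul_one]
  have hle : ∫ x in Set.Ioi 0, (h x * gpdf n μ x - h t * gpdf n μ x) ≤
      ∫ x in Set.Ioi 0, (h x * gpdf (n + 1) μ x - h t * gpdf (n + 1) μ x) := by
    refine setIntegral_mono_on ((hi n).sub ((integrableOn_gpdf hμ n).const_mul _))
      ((hi (n + 1)).sub ((integrableOn_gpdf hμ (n + 1)).const_mul _)) measurableSet_Ioi ?_
    intro x hx
    have hfactor : h x * gpdf (n + 1) μ x - h t * gpdf (n + 1) μ x -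
        (h x * gpdf n μ x - h t * gpdf n μ x) =
        μ / (n + 1) * gpdf n μ x * ((h x - h t) * (x - t)) := by
      rw [gpdf_succ, ht]
      have : (n : ℝ) + 1 ≠ 0 := by positivity
      field_simp
    have hsign : 0 ≤ (h x - h t) * (x - t) := by
      rcases le_total x t with hxt | hxt
      · exact mul_nonneg_of_nonpos_of_nonpos (sub_nonpos.2 (hh hxt)) (sub_nonpos.2 hxt)
      · exact mul_nonneg (sub_nonneg.2 (hh hxt)) (sub_nonneg.2 hxt)
    have := gpdf_nonneg hμ (le_of_lt hx) n
    rw [← sub_nonneg, hfactor]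
    positivity
  rw [hcentered, hcentered] at hle
  linarith

theorem integrableOn_lateness_mul_gpdf {μ d : ℝ} (hμ : 0 < μ) (hd : 0 ≤ d) (n : ℕ) :
    IntegrableOn (fun x => max (x - d) 0 * gpdf n μ x) (Set.Ioi 0) := by
  refine Integrable.mono' ((integrableOn_gpdf hμ (n + 1)).const_mul ((n + 1) / μ)) ?_ ?_
  · exact Continuous.aestronglyMeasurable (by unfold gpdf; fun_prop)
  · filter_upwards [ae_restrict_mem measurableSet_Ioi] with x hx
    have hx0 : 0 ≤ x := le_of_lt hx
    have hg := gpdf_nonneg hμ hx0 n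
    rw [Real.norm_of_nonneg (by positivity), gpdf_succ]
    have hx_eq : (n + 1) / μ * (μ * x / (n + 1) * gpdf n μ x) = x * gpdf n μ x := by
      field_simp
    rw [hx_eq]
    exact mul_le_mul_of_nonneg_right (max_le (by linarith) hx0) hg

theorem Ln_eq_setIntegral {d : ℝ} (hd : 0 ≤ d) (μ : ℝ) (n : ℕ) :
    Ln μ n d = ∫ x in Set.Ioi 0, max (x - d) 0 * gpdf n μ x := by
  rw [Ln, setIntegral_eq_of_subset_of_forall_sdiff_eq_zero (s := Set.Ioi d) (t := Set.Ioi 0)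
    measurableSet_Ioi (Set.Ioi_subset_Ioi hd)]
  · refine setIntegral_congr_fun measurableSet_Ioi fun x hx => ?_
    simp only [Set.mem_Ioi] at hx
    simp [max_eq_left (sub_nonneg.2 hx.le)]
  · rintro x ⟨-, hx⟩
    have : x - d ≤ 0 := by simpa using hx
    simp [max_eq_right this]

theorem Ln_le_succ {μ d : ℝ} (hμ : 0 < μ) (hd : 0 ≤ d) (n : ℕ) : Ln μ n d ≤ Ln μ (n + 1) d := by
  rw [Ln_eq_setIntegral hd, Ln_eq_setIntegral hd]
  refine setIntegral_mul_gpdf_le_succ hμ n (fun x y hxy => ?_)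
    (integrableOn_lateness_mul_gpdf hμ hd)
  gcongr

/-- The CARA utility of a customer with sojourn time `x` under quote `d`. -/
noncomputable def caraUtility (R p c l r d x : ℝ) : ℝ :=
  (1 - Real.exp (-(r * (R - p - l * min x d - (c - l) * x)))) / r

theorem caraUtility_antitone {R p c l r : ℝ} (hl0 : 0 ≤ l) (hlc : l ≤ c) (hr : 0 < r) (d : ℝ) :
    Antitone (caraUtility R p c l r d) := by
  intro x y hxy
  have : 0 ≤ c - l := sub_nonneg.2 hlc
  unfold caraUtility
  gcongr

theorem integrableOn_caraUtility_mul_gpdf {R p c l r μ : ℝ} (hl0 : 0 ≤ l) (hr : 0 < r)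
    (hμ0 : 0 < μ) (hμ : r * (c - l) < μ) (d : ℝ) (n : ℕ) :
    IntegrableOn (fun x => caraUtility R p c l r d x * gpdf n μ x) (Set.Ioi 0) := by
  refine Integrable.mono' (((integrableOn_gpdf hμ0 n).add
    ((integrableOn_exp_mul_gpdf hμ n).const_mul (Real.exp (-(r * (R - p - l * d)))))).const_mul
      (1 / r)) ?_ ?_
  · exact Continuous.aestronglyMeasurable (by unfold gpdf caraUtility; fun_prop)
  · filter_upwards [ae_restrict_mem measurableSet_Ioi] with x hx
    have hg := gpdf_nonneg hμ0 (le_of_lt hx) n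
    have hexp : Real.exp (-(r * (R - p - l * min x d - (c - l) * x))) ≤
        Real.exp (-(r * (R - p - l * d))) * Real.exp (r * (c - l) * x) := by
      rw [← Real.exp_add, Real.exp_le_exp]
      have := mul_le_mul_of_nonneg_left (min_le_right x d) (mul_nonneg hr.le hl0)
      linarith
    have habs : |caraUtility R p c l r d x| ≤
        1 / r * (1 + Real.exp (-(r * (R - p - l * d))) * Real.exp (r * (c - l) * x)) := by
      rw [caraUtility, abs_div, abs_of_pos hr, div_eq_mul_one_div, mul_comm]
      gcongr
      rw [abs_le]
      have := Real.exp_pos (-(r * (R - p - l * min x d - (c - l) * x)))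
      constructor <;> linarith
    rw [norm_mul, Real.norm_eq_abs, Real.norm_of_nonneg hg]
    calc _ ≤ _ := mul_le_mul_of_nonneg_right habs hg
      _ = _ := by simp only [Pi.add_apply]; ring

theorem Bn_eq_setIntegral {R p c l r μ d : ℝ} (hl0 : 0 ≤ l) (hr : 0 < r)
    (hμ0 : 0 < μ) (hμ : r * (c - l) < μ) (hd : 0 ≤ d) (n : ℕ) :
    Bn R p c l r μ n d = ∫ x in Set.Ioi 0, caraUtility R p c l r d x * gpdf n μ x := by
  have hi := integrableOn_caraUtility_mul_gpdf (R := R) (p := p) hl0 hr hμ0 hμ d n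
  rw [← Set.Ioc_union_Ioi_eq_Ioi hd, setIntegral_union Set.Ioc_disjoint_Ioi_same
    measurableSet_Ioi (hi.mono_set Set.Ioc_subset_Ioi_self)
    (hi.mono_set (Set.Ioi_subset_Ioi hd)), Bn, intervalIntegral.integral_of_le hd]
  congr 1
  · refine setIntegral_congr_fun measurableSet_Ioc fun x hx => ?_
    simp only [caraUtility, min_eq_left hx.2]
    ring_nf
  · refine setIntegral_congr_fun measurableSet_Ioi fun x hx => ?_
    simp only [caraUtility, min_eq_right (Set.mem_Ioi.1 hx).le]

theorem Bn_succ_le {R p c l r μ d : ℝ} (hl0 : 0 ≤ l) (hlc : l ≤ c) (hr : 0 < r)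
    (hμ0 : 0 < μ) (hμ : r * (c - l) < μ) (hd : 0 ≤ d) (n : ℕ) :
    Bn R p c l r μ (n + 1) d ≤ Bn R p c l r μ n d := by
  rw [Bn_eq_setIntegral hl0 hr hμ0 hμ hd, Bn_eq_setIntegral hl0 hr hμ0 hμ hd]
  have h := setIntegral_mul_gpdf_le_succ hμ0 n
    (h := fun x => -caraUtility R p c l r d x) (caraUtility_antitone hl0 hlc hr d).neg (fun m => by
      simp only [neg_mul]
      exact (integrableOn_caraUtility_mul_gpdf (R := R) (p := p) hl0 hr hμ0 hμ d m).neg)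
  simp only [neg_mul, integral_neg] at h
  linarith

theorem Gn_succ_le {p l μ d : ℝ} (hl0 : 0 ≤ l) (hμ0 : 0 < μ) (hd : 0 ≤ d) (n : ℕ) :
    Gn p l μ (n + 1) d ≤ Gn p l μ n d :=
  sub_le_sub_left (mul_le_mul_of_nonneg_left (Ln_le_succ hμ0 hd n) hl0) p

/-- The optimal social benefit per joining customer is nonincreasing in the number of
customers present. -/
theorem optimal_social_benefit_monotone
    (R p c l r μ : ℝ) (hpR : p ≤ R) (hc : 0 < c) (hl0 : 0 ≤ l) (hlc : l ≤ c)
    (hr : 0 < r) (hμ0 : 0 < μ) (hμ : r * (c - l) < μ) (n : ℕ) (s s' : ℝ)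
    (hs0 : 0 ≤ s) (hsfeas : 0 ≤ Bn R p c l r μ (n + 1) s)
    (hsmax : ∀ d, 0 ≤ d → 0 ≤ Bn R p c l r μ (n + 1) d →
      Gn p l μ (n + 1) d + Bn R p c l r μ (n + 1) d ≤
        Gn p l μ (n + 1) s + Bn R p c l r μ (n + 1) s)
    (hs'0 : 0 ≤ s') (hs'feas : 0 ≤ Bn R p c l r μ n s')
    (hs'max : ∀ d, 0 ≤ d → 0 ≤ Bn R p c l r μ n d →
      Gn p l μ n d + Bn R p c l r μ n d ≤ Gn p l μ n s' + Bn R p c l r μ n s') :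
    Gn p l μ (n + 1) s + Bn R p c l r μ (n + 1) s ≤
      Gn p l μ n s' + Bn R p c l r μ n s' := by
  have hB := Bn_succ_le (R := R) (p := p) hl0 hlc hr hμ0 hμ hs0 n
  exact (add_le_add (Gn_succ_le hl0 hμ0 hs0 n) hB).trans (hs'max s hs0 (hsfeas.trans hB))
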